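/- Let T be a tree on n ≥ 2 vertices and let H° be its open neighborhood hypergraph. Then δ̂(H°) ≤ 2, and consequently δ̌(H°) ≤ 2. -/

import Mathlib

open Finset

variable {V : Type*}

/-- Degree of a vertex `x` in a hypergraph with edge set `F`:
the number of edges containing `x`. -/
def hdeg [DecidableEq V] (F : Finset (Finset V)) (x : V) : ℕ :=
  (F.filter fun e => x ∈ e).card

/-- Minimum degree over the vertex set `S` of a hypergraph with edge set `F`
(`0` if `S` is empty). -/
def hminDeg [DecidableEq V] (F : Finset (Finset V)) (S : Finset V) : ℕ :=
  if h : S.Nonempty then S.inf' h (hdeg F) else 0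

/-- Edge set of the restriction `H[S]`: the distinct traces `e ∩ S` of edges. -/
def hrestrict [DecidableEq V] (E : Finset (Finset V)) (S : Finset V) : Finset (Finset V) :=
  E.image fun e => e ∩ S

/-- Edge set of the pseudo induced subhypergraph on `S`: edges contained in `S`. -/
def hpseudo [DecidableEq V] (E : Finset (Finset V)) (S : Finset V) : Finset (Finset V) :=
  E.filter fun e => e ⊆ S

/-- Degeneracy of the hypergraph with vertex set `W` and edge set `E`:
the largest minimum degree of an induced subhypergraph. -/
def degenOn [DecidableEq V] (E : Finset (Finset V)) (W : Finset V) : ℕ :=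
  W.powerset.sup fun S => hminDeg (hrestrict E S) S

/-- Pseudo degeneracy of the hypergraph with vertex set `W` and edge set `E`. -/
def pdegenOn [DecidableEq V] (E : Finset (Finset V)) (W : Finset V) : ℕ :=
  W.powerset.sup fun S => hminDeg (hpseudo E S) S

/-- Reduced degeneracy of the hypergraph with vertex set `W` and edge set `E`:
the largest pseudo degeneracy of an induced subhypergraph. -/
def rdegenOn [DecidableEq V] (E : Finset (Finset V)) (W : Finset V) : ℕ :=
  W.powerset.sup fun S => pdegenOn (hrestrict E S) S

def degen [DecidableEq V] [Fintype V] (E : Finset (Finset V)) : ℕ := degenOn E univ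
def pdegen [DecidableEq V] [Fintype V] (E : Finset (Finset V)) : ℕ := pdegenOn E univ
def rdegen [DecidableEq V] [Fintype V] (E : Finset (Finset V)) : ℕ := rdegenOn E univ

/-- The distinct nonempty traces of the edges `E` on the set `S`. -/
def ntraces [DecidableEq V] (E : Finset (Finset V)) (S : Finset V) : Finset (Finset V) :=
  (hrestrict E S).erase ∅

/-- The trace function `T[H,k]`: the largest number of distinct nonempty traces
of `E` on a `k`-element vertex subset. -/
def traceFn [DecidableEq V] [Fintype V] (E : Finset (Finset V)) (k : ℕ) : ℕ :=
  (univ.powerset.filter fun S : Finset V => S.card = k).sup fun S => (ntraces E S).card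

/-- The edge set of the closed neighborhood hypergraph of a graph `G`:
the distinct closed neighborhoods `N[x]`. -/
def closedNH [DecidableEq V] [Fintype V] (G : SimpleGraph V) [DecidableRel G.Adj] :
    Finset (Finset V) :=
  univ.image fun x => insert x (G.neighborFinset x)

/-- The edge set of the open neighborhood hypergraph of a graph `G`:
the distinct open neighborhoods `N(x)`. -/
def openNH [DecidableEq V] [Fintype V] (G : SimpleGraph V) [DecidableRel G.Adj] :
    Finset (Finset V) :=
  univ.image fun x => G.neighborFinset x

theorem tree_parent_unique {W : Type*} {G : SimpleGraph W} (hT : G.IsTree) (r : W) {v a b : W}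
    (ha : G.Adj v a) (hb : G.Adj v b) (hda : G.dist r v = G.dist r a + 1)
    (hdb : G.dist r v = G.dist r b + 1) : a = b := by
  obtain ⟨p, hp, hp'⟩ := (hT.connected r a).exists_path_of_dist
  obtain ⟨q, hq, hq'⟩ := (hT.connected r b).exists_path_of_dist
  have h1 : (p.concat ha.symm).IsPath :=
    SimpleGraph.Walk.isPath_of_length_eq_dist _ (by rw [SimpleGraph.Walk.length_concat]; omega)
  have h2 : (q.concat hb.symm).IsPath :=
    SimpleGraph.Walk.isPath_of_length_eq_dist _ (by rw [SimpleGraph.Walk.length_concat]; omega)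
  have h3 : p.concat ha.symm = q.concat hb.symm := (hT.existsUnique_path r v).unique h1 h2
  have h4 := congrArg SimpleGraph.Walk.penultimate h3
  simpa using h4

theorem exists_hdeg_le_two [DecidableEq V] [Fintype V] (G : SimpleGraph V) [DecidableRel G.Adj]
    (hT : G.IsTree) (S : Finset V) (hS : S.Nonempty) :
    ∃ x ∈ S, hdeg (hrestrict (openNH G) S) x ≤ 2 := by
  obtain ⟨r, -⟩ := id hS
  obtain ⟨x, hx, hmax⟩ := S.exists_max_image (fun v => G.dist r v) hS
  refine ⟨x, hx, ?_⟩
  have child : ∀ y, G.Adj y x → G.dist r y = G.dist r x + 1 →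
      G.neighborFinset y ∩ S = {x} := by
    intro y hy hd
    ext z
    simp only [Finset.mem_inter, SimpleGraph.mem_neighborFinset, Finset.mem_singleton]
    constructor
    · rintro ⟨hz, hzS⟩
      have := hmax z hzS
      rcases hT.dist_eq_dist_add_one_of_adj r hz with h | h
      · exact tree_parent_unique hT r hz hy h hd
      · omega
    · rintro rfl
      exact ⟨hy, hx⟩
  obtain ⟨t, ht⟩ : ∃ t : Finset V, ∀ y, G.Adj y x → G.dist r x = G.dist r y + 1 →
      G.neighborFinset y ∩ S = t := by
    by_cases h : ∃ p, G.Adj p x ∧ G.dist r x = G.dist r p + 1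
    · obtain ⟨p, hp, hpd⟩ := h
      refine ⟨G.neighborFinset p ∩ S, fun y hy hd => ?_⟩
      rw [tree_parent_unique hT r hy.symm hp.symm hd hpd]
    · exact ⟨∅, fun y hy hd => (h ⟨y, hy, hd⟩).elim⟩
  refine (Finset.card_le_card (t := {{x}, t}) ?_).trans Finset.card_le_two
  intro e he
  simp only [hrestrict, openNH, Finset.mem_filter, Finset.mem_image, Finset.mem_univ, true_and,
    exists_exists_eq_and] at he
  obtain ⟨⟨y, rfl⟩, hxe⟩ := he
  have hy : G.Adj y x := by simpa using (Finset.mem_inter.1 hxe).1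
  rcases hT.dist_eq_dist_add_one_of_adj r hy with h | h
  · simp [child y hy h]
  · simp [ht y hy h]

theorem hminDeg_le [DecidableEq V] (F : Finset (Finset V)) (S : Finset V) (x : V) (hx : x ∈ S) :
    hminDeg F S ≤ hdeg F x := by
  unfold hminDeg
  rw [dif_pos ⟨x, hx⟩]
  exact Finset.inf'_le _ hx

/-- if `T` is a tree on `n ≥ 2` vertices and `H°` is its open
neighborhood hypergraph, then `δ̂(H°) ≤ 2`, and consequently `δ̌(H°) ≤ 2`. -/
theorem stmt15 [DecidableEq V] [Fintype V] (G : SimpleGraph V) [DecidableRel G.Adj]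
    (hT : G.IsTree) (hn : 2 ≤ Fintype.card V) :
    degen (openNH G) ≤ 2 ∧ rdegen (openNH G) ≤ 2 := by
  refine ⟨Finset.sup_le fun S _ => ?_, Finset.sup_le fun S _ => Finset.sup_le fun R hR => ?_⟩
  · rcases S.eq_empty_or_nonempty with rfl | hS
    · simp [hminDeg]
    · obtain ⟨x, hx, h⟩ := exists_hdeg_le_two G hT S hS
      exact (hminDeg_le _ S x hx).trans h
  · rcases R.eq_empty_or_nonempty with rfl | hS
    · simp [hminDeg]
    · obtain ⟨x, hx, h⟩ := exists_hdeg_le_two G hT R hS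
      refine (hminDeg_le _ R x hx).trans (le_trans (Finset.card_le_card ?_) h)
      refine Finset.filter_subset_filter _ ?_
      intro e he
      have hRS := Finset.mem_powerset.1 hR
      obtain ⟨he1, he2⟩ := Finset.mem_filter.1 he
      obtain ⟨f, hf, rfl⟩ := Finset.mem_image.1 he1
      refine Finset.mem_image.2 ⟨f, hf, ?_⟩
      apply Finset.Subset.antisymm
      · exact Finset.inter_subset_inter_left hRS
      · exact Finset.subset_inter Finset.inter_subset_left he2
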